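/- Define the clock distance d(i, j) = min(|i − j|, 12 − |i − j|) on {0, …, 11}, and for 0 < ε < 1 define 12×12 matrices Â and Ã that agree with d outside row 0 and have row 0 given by: Â(0, l) = d(0, l) − 1 − 2ε for l ≠ 5 and Â(0, 5) = d(0, 5) + 1 − ε; Ã(0, l) = d(0, l) − 1 + ε for l ≠ 7 and Ã(0, 7) = d(0, 7) + 1 − ε. Then: (i) for every j ≠ 5 and every k, Â(0, 5) + d(5, k) > Â(0, j) + d(j, k) (position 5 is strictly dominant for player 2 against player 1's fixed position 0); (ii) for every k ≠ 7, Ã(0, 7) + d(5, 7) > Ã(0, k) + d(5, k) (position 7 is the unique best response for player 3 against positions 0 of player 1 and 5 of player 2); (iii) ‖Â − D‖∞ = 1 + 2ε and ‖Ã − D‖∞ = 1 − ε, and the single-round utilities at the profile (0, 5, 7) satisfy u1 = d(0, 5) + d(0, 7) − ‖Â − D‖∞ − ‖Ã − D‖∞ = 8 − ε, u2 = Â(0, 5) + d(5, 7) = 8 − ε, and u3 = Ã(0, 7) + d(5, 7) = 8 − ε, so all three players' single-round utilities are equal. (Dominance solvable policy guiding the social distancing game to an approximately socially optimal, equal-utility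 outcome.) -/

import Mathlib

/-- The clock distance between two of the 12 positions, as a natural number. -/
def clockDistN (i j : Fin 12) : ℕ :=
  min ((i.val : ℤ) - (j.val : ℤ)).natAbs (12 - ((i.val : ℤ) - (j.val : ℤ)).natAbs)

/-- The clock distance as a real number. -/
noncomputable def clockDist (i j : Fin 12) : ℝ := (clockDistN i j : ℝ)

/-- The original payoff matrix of the social distancing game: the distance matrix. -/
noncomputable def Dmat : Matrix (Fin 12) (Fin 12) ℝ := fun i j => clockDist i j

/-- Player 2's manipulated matrix `Â`: agrees with the distance matrix outside row 0;
row 0 rewards position 5. -/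
noncomputable def Ahat (ε : ℝ) : Matrix (Fin 12) (Fin 12) ℝ := fun k l =>
  if k = 0 then
    (if l = 5 then clockDist k l + 1 - ε else clockDist k l - 1 - 2 * ε)
  else clockDist k l

/-- Player 3's manipulated matrix `Ã`: agrees with the distance matrix outside row 0;
row 0 rewards position 7. -/
noncomputable def Atil (ε : ℝ) : Matrix (Fin 12) (Fin 12) ℝ := fun k l =>
  if k = 0 then
    (if l = 7 then clockDist k l + 1 - ε else clockDist k l - 1 + ε)
  else clockDist k l

/-- The infinity norm of a payoff matrix: the maximum absolute value of an entry. -/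
noncomputable def infNorm {n m : ℕ} (A : Matrix (Fin n) (Fin m) ℝ) : ℝ :=
  ⨆ i, ⨆ j, |A i j|

/-- A bound on the absolute values of the entries that is attained is the infinity norm. -/
theorem infNorm_eq_of_forall_le {n m : ℕ} {A : Matrix (Fin n) (Fin m) ℝ} {c : ℝ}
    (hle : ∀ i j, |A i j| ≤ c) (i : Fin n) (j : Fin m) (hij : |A i j| = c) :
    infNorm A = c := by
  have hc : 0 ≤ c := hij ▸ abs_nonneg _
  apply le_antisymm
  · exact Real.iSup_le (fun i => Real.iSup_le (hle i) hc) hc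
  · calc c = |A i j| := hij.symm
      _ ≤ ⨆ l, |A i l| := le_ciSup (f := fun l => |A i l|) (Set.finite_range _).bddAbove j
      _ ≤ infNorm A :=
        le_ciSup (f := fun k => ⨆ l, |A k l|) (Set.finite_range _).bddAbove i

theorem Ahat_sub_Dmat_apply (ε : ℝ) (k l : Fin 12) :
    (Ahat ε - Dmat) k l = if k = 0 then (if l = 5 then 1 - ε else -(1 + 2 * ε)) else 0 := by
  simp only [Matrix.sub_apply, Ahat, Dmat]
  split_ifs <;> ring

theorem Atil_sub_Dmat_apply (ε : ℝ) (k l : Fin 12) :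
    (Atil ε - Dmat) k l = if k = 0 then (if l = 7 then 1 - ε else -(1 - ε)) else 0 := by
  simp only [Matrix.sub_apply, Atil, Dmat]
  split_ifs <;> ring

theorem infNorm_Ahat_sub_Dmat {ε : ℝ} (hε : 0 < ε) (hε' : ε < 1) :
    infNorm (Ahat ε - Dmat) = 1 + 2 * ε := by
  refine infNorm_eq_of_forall_le (fun k l => ?_) 0 0 ?_
  · rw [Ahat_sub_Dmat_apply, abs_le]
    split_ifs <;> constructor <;> linarith
  · rw [Ahat_sub_Dmat_apply, if_pos rfl, if_neg (by decide), abs_neg, abs_of_pos (by linarith)]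

theorem infNorm_Atil_sub_Dmat {ε : ℝ} (hε' : ε < 1) :
    infNorm (Atil ε - Dmat) = 1 - ε := by
  refine infNorm_eq_of_forall_le (fun k l => ?_) 0 7 ?_
  · rw [Atil_sub_Dmat_apply, abs_le]
    split_ifs <;> constructor <;> linarith
  · rw [Atil_sub_Dmat_apply, if_pos rfl, if_pos rfl, abs_of_pos (by linarith)]

theorem clockDist_add_le_add_two (j k : Fin 12) :
    clockDist 0 j + clockDist j k ≤ clockDist 0 5 + clockDist 5 k + 2 := by
  have h : ∀ j k : Fin 12,
      clockDistN 0 j + clockDistN j k ≤ clockDistN 0 5 + clockDistN 5 k + 2 := by decide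
  unfold clockDist
  exact_mod_cast h j k

theorem clockDist_zero_add_five_le (k : Fin 12) : clockDist 0 k + clockDist 5 k ≤ 7 := by
  have h : ∀ k : Fin 12, clockDistN 0 k + clockDistN 5 k ≤ 7 := by decide
  unfold clockDist
  exact_mod_cast h k

theorem clockDist_zero_five : clockDist 0 5 = 5 := by
  have h : clockDistN 0 5 = 5 := by decide
  simp [clockDist, h]

theorem clockDist_zero_seven : clockDist 0 7 = 5 := by
  have h : clockDistN 0 7 = 5 := by decide
  simp [clockDist, h]

theorem clockDist_five_seven : clockDist 5 7 = 2 := by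
  have h : clockDistN 5 7 = 2 := by decide
  simp [clockDist, h]

/-- Dominance solvable policy guiding the social distancing game to an approximately
socially optimal, equal-utility outcome at the profile `(0, 5, 7)`: every player's
single-round utility equals `8 - ε`. -/
theorem stmt_13 (ε : ℝ) (hε : 0 < ε) (hε' : ε < 1) :
    (∀ j : Fin 12, j ≠ 5 → ∀ k : Fin 12,
      Ahat ε 0 5 + clockDist 5 k > Ahat ε 0 j + clockDist j k) ∧
    (∀ k : Fin 12, k ≠ 7 →
      Atil ε 0 7 + clockDist 5 7 > Atil ε 0 k + clockDist 5 k) ∧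
    infNorm (Ahat ε - Dmat) = 1 + 2 * ε ∧
    infNorm (Atil ε - Dmat) = 1 - ε ∧
    clockDist 0 5 + clockDist 0 7
      - infNorm (Ahat ε - Dmat) - infNorm (Atil ε - Dmat) = 8 - ε ∧
    Ahat ε 0 5 + clockDist 5 7 = 8 - ε ∧
    Atil ε 0 7 + clockDist 5 7 = 8 - ε := by
  have hA : Ahat ε 0 5 = 6 - ε := by
    simp only [Ahat, if_true, clockDist_zero_five]
    ring
  have hB : Atil ε 0 7 = 6 - ε := by
    simp only [Atil, if_true, clockDist_zero_seven]
    ring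
  rw [infNorm_Ahat_sub_Dmat hε hε', infNorm_Atil_sub_Dmat hε', hA, hB, clockDist_zero_five,
    clockDist_zero_seven, clockDist_five_seven]
  refine ⟨fun j hj k => ?_, fun k hk => ?_, rfl, rfl, by ring, by ring, by ring⟩
  · have h := clockDist_add_le_add_two j k
    rw [clockDist_zero_five] at h
    simp only [Ahat, if_true, if_neg hj]
    linarith
  · have h := clockDist_zero_add_five_le k
    simp only [Atil, if_true, if_neg hk]
    linarith
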